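/- The following two statements are equivalent: (a) there exist a homogeneous ideal I ⊆ R and an integer j_0 such that dim_k (R/I)_j = p(j) for all integers j ≥ j_0; (b) there exist an integer r ≥ 0 and integers λ_1 ≥ λ_2 ≥ ⋯ ≥ λ_r ≥ 1 such that p(t) = Σ_{i=1}^{r} C(t + λ_i − i, λ_i − 1) as polynomials in ℚ[t]. -/

import Mathlib

open MvPolynomial

noncomputable section

/-- The degree-`j` graded component of `R/I`, realized as the image of the space of
homogeneous polynomials of degree `j` in the quotient `R ⧸ I`. -/
def gradedPiece (k : Type*) [Field k] (m : ℕ) (I : Ideal (MvPolynomial (Fin (m + 1)) k))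
    (j : ℕ) : Submodule k (MvPolynomial (Fin (m + 1)) k ⧸ I) :=
  (homogeneousSubmodule (Fin (m + 1)) k j).map (Ideal.Quotient.mkₐ k I).toLinearMap

/-- `dim_k (R/I)_j`. -/
def hdim (k : Type*) [Field k] (m : ℕ) (I : Ideal (MvPolynomial (Fin (m + 1)) k)) (j : ℕ) : ℕ :=
  Module.finrank k (gradedPiece k m I j)

/-- The polynomial `C(t + λᵢ − i, λᵢ − 1) = (1/(λᵢ−1)!)·∏_{t=0}^{λᵢ−2} (X + λᵢ − i − t) ∈ ℚ[t]`;
when `λᵢ = 1` the product is empty and the polynomial is the constant `1`. -/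
def binPoly (li i : ℕ) : Polynomial ℚ :=
  Polynomial.C (1 / (Nat.factorial (li - 1) : ℚ)) *
    ∏ t ∈ Finset.range (li - 1), (Polynomial.X + Polynomial.C ((li : ℚ) - (i : ℚ) - (t : ℚ)))

/-- exponent vectors of total degree `d` -/
def DD (n d : ℕ) : Finset (Fin n → ℕ) := Finset.piAntidiag Finset.univ d

lemma mem_DD {n d : ℕ} {u : Fin n → ℕ} : u ∈ DD n d ↔ ∑ i, u i = d := by
  simp [DD]

/-- lexicographic strict order -/
def LT' {n : ℕ} (u v : Fin n → ℕ) : Prop := toLex u < toLex v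

lemma LT'_iff {n : ℕ} {u v : Fin n → ℕ} :
    LT' u v ↔ ∃ k, (∀ j, j < k → u j = v j) ∧ u k < v k := Iff.rfl

lemma LT'.trans {n : ℕ} {u v w : Fin n → ℕ} (h : LT' u v) (h' : LT' v w) : LT' u w :=
  lt_trans (α := Lex (Fin n → ℕ)) h h'

lemma LT'.irrefl {n : ℕ} (u : Fin n → ℕ) : ¬ LT' u u := lt_irrefl (α := Lex (Fin n → ℕ)) _

lemma LT'.tri {n : ℕ} (u v : Fin n → ℕ) : LT' u v ∨ u = v ∨ LT' v u :=
  lt_trichotomy (α := Lex (Fin n → ℕ)) u v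

lemma LT'.add {n : ℕ} {u v : Fin n → ℕ} (w : Fin n → ℕ) (h : LT' u v) : LT' (u + w) (v + w) := by
  rw [LT'_iff] at *
  obtain ⟨k, h1, h2⟩ := h
  exact ⟨k, fun j hj => by simp [h1 j hj], by simpa using h2⟩

/-- initial lex segments in degree `d` -/
def IsInit {n : ℕ} (d : ℕ) (B : Finset (Fin n → ℕ)) : Prop :=
  B ⊆ DD n d ∧ ∀ u ∈ B, ∀ v ∈ DD n d, LT' v u → v ∈ B

lemma exists_init (n d k : ℕ) (hk : k ≤ (DD n d).card) :
    ∃ B : Finset (Fin n → ℕ), IsInit d B ∧ B.card = k := by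
  induction k with
  | zero => exact ⟨∅, ⟨by simp, by simp⟩, by simp⟩
  | succ k ih =>
    obtain ⟨B, hB, hc⟩ := ih (by omega)
    have hne : (DD n d \ B).Nonempty := by
      rw [← Finset.card_pos]
      have := Finset.le_card_sdiff B (DD n d)
      omega
    obtain ⟨u, hu, hmin⟩ := Finset.exists_min_image (DD n d \ B) (fun u => toLex u) hne
    rw [Finset.mem_sdiff] at hu
    refine ⟨insert u B, ⟨?_, ?_⟩, by rw [Finset.card_insert_of_notMem hu.2, hc]⟩
    · intro x hx
      rcases Finset.mem_insert.1 hx with rfl | hx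
      · exact hu.1
      · exact hB.1 hx
    · intro x hx v hv hvx
      rcases Finset.mem_insert.1 hx with rfl | hx
      · by_contra hvB
        have := hmin v (by
          rw [Finset.mem_sdiff]
          exact ⟨hv, fun h => hvB (Finset.mem_insert_of_mem h)⟩)
        exact absurd hvx (not_lt.2 this)
      · exact Finset.mem_insert_of_mem (hB.2 x hx v hv hvx)

lemma init_subset {n d : ℕ} {A B : Finset (Fin n → ℕ)} (hA : IsInit d A) (hB : IsInit d B)
    (h : A.card ≤ B.card) : A ⊆ B := by
  by_contra hn
  obtain ⟨u, huA, huB⟩ := Finset.not_subset.1 hn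
  have hBA : B ⊆ A := by
    intro v hv
    rcases LT'.tri u v with h1 | rfl | h1
    · exact absurd (hB.2 v hv u (hA.1 huA) h1) huB
    · exact huA
    · exact hA.2 u huA v (hB.1 hv) h1
  have := Finset.eq_of_subset_of_card_le hBA h
  exact huB (this ▸ huA)

/-- unit vector -/
def ee {n : ℕ} (i : Fin n) : Fin n → ℕ := Pi.single i 1

/-- lower shadow -/
def shad {n : ℕ} (A : Finset (Fin n → ℕ)) : Finset (Fin n → ℕ) :=
  Finset.univ.biUnion (fun i => A.preimage (fun w => w + ee i) (add_left_injective _).injOn)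

lemma mem_shad {n : ℕ} {A : Finset (Fin n → ℕ)} {w : Fin n → ℕ} :
    w ∈ shad A ↔ ∃ i, w + ee i ∈ A := by
  simp [shad]

lemma sum_add_ee {n : ℕ} (w : Fin n → ℕ) (i : Fin n) : ∑ j, (w + ee i) j = (∑ j, w j) + 1 := by
  simp [ee, Finset.sum_add_distrib]

lemma shad_mono {n : ℕ} {A B : Finset (Fin n → ℕ)} (h : A ⊆ B) : shad A ⊆ shad B := by
  intro w
  simp only [mem_shad]
  rintro ⟨i, hi⟩
  exact ⟨i, h hi⟩

lemma shad_deg {n d : ℕ} {A : Finset (Fin n → ℕ)} (h : A ⊆ DD n (d + 1)) : shad A ⊆ DD n d := by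
  intro w
  simp only [mem_shad]
  rintro ⟨i, hi⟩
  have := mem_DD.1 (h hi)
  rw [sum_add_ee] at this
  rw [mem_DD]; omega

lemma shad_zero {n : ℕ} {A : Finset (Fin n → ℕ)} (h : A ⊆ DD n 0) : shad A = ∅ := by
  rw [Finset.eq_empty_iff_forall_notMem]
  intro w
  simp only [mem_shad]
  rintro ⟨i, hi⟩
  have := mem_DD.1 (h hi)
  rw [sum_add_ee] at this
  omega

lemma init_shad {n d : ℕ} {A : Finset (Fin n → ℕ)} (h : IsInit (d + 1) A) : IsInit d (shad A) := by
  refine ⟨shad_deg h.1, ?_⟩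
  intro u hu v hv hvu
  rw [mem_shad] at *
  obtain ⟨i, hi⟩ := hu
  refine ⟨i, h.2 _ hi _ ?_ (hvu.add _)⟩
  rw [mem_DD, sum_add_ee, mem_DD.1 hv]

/-- strongly stable -/
def SS {n : ℕ} (A : Finset (Fin n → ℕ)) : Prop :=
  ∀ (w : Fin n → ℕ) (i j : Fin n), i < j → w + ee i ∈ A → w + ee j ∈ A

lemma LT'_ee {n : ℕ} (w : Fin n → ℕ) {i j : Fin n} (h : i < j) : LT' (w + ee j) (w + ee i) := by
  rw [LT'_iff]
  refine ⟨i, fun l hl => ?_, ?_⟩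
  · have h1 : l ≠ i := hl.ne
    have h2 : l ≠ j := (hl.trans h).ne
    simp [ee, h1, h2]
  · have h2 : i ≠ j := h.ne
    simp [ee, h2]

lemma init_SS {n d : ℕ} {A : Finset (Fin n → ℕ)} (h : IsInit d A) : SS A := by
  intro w i j hij hw
  refine h.2 _ hw _ ?_ (LT'_ee w hij)
  have := mem_DD.1 (h.1 hw)
  rw [mem_DD]
  rw [sum_add_ee] at *
  exact this

/-- insertion of a coordinate -/
def ins {n : ℕ} (i : Fin (n + 1)) (b : ℕ) (w : Fin n → ℕ) : Fin (n + 1) → ℕ :=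
  Fin.insertNth (α := fun _ => ℕ) i b w

lemma ins_same {n : ℕ} (i : Fin (n + 1)) (b : ℕ) (w : Fin n → ℕ) : ins i b w i = b := by
  simp [ins]

lemma ins_succAbove {n : ℕ} (i : Fin (n + 1)) (b : ℕ) (w : Fin n → ℕ) (j : Fin n) :
    ins i b w (i.succAbove j) = w j := by
  simp [ins]

lemma ins_surj {n : ℕ} (i : Fin (n + 1)) (u : Fin (n + 1) → ℕ) :
    ∃ w, u = ins i (u i) w :=
  ⟨i.removeNth u, by simp [ins]⟩

lemma ins_inj {n : ℕ} {i : Fin (n + 1)} {b c : ℕ} {w v : Fin n → ℕ} :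
    ins i b w = ins i c v ↔ b = c ∧ w = v := by
  simp only [ins]
  exact Fin.insertNth_inj

lemma sum_ins {n : ℕ} (i : Fin (n + 1)) (b : ℕ) (w : Fin n → ℕ) :
    ∑ j, ins i b w j = b + ∑ j, w j := by
  rw [Fin.sum_univ_succAbove _ i]
  simp [ins_same, ins_succAbove]

lemma ins_add_succAbove {n : ℕ} (i : Fin (n + 1)) (b : ℕ) (w : Fin n → ℕ) (j : Fin n) :
    ins i b w + ee (i.succAbove j) = ins i b (w + ee j) := by
  funext l
  induction l using Fin.succAboveCases i with
  | x => simp [ins_same, ee]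
  | p l => simp [ins_succAbove, ee, Pi.single_apply]

lemma ins_add_same {n : ℕ} (i : Fin (n + 1)) (b : ℕ) (w : Fin n → ℕ) :
    ins i b w + ee i = ins i (b + 1) w := by
  funext l
  induction l using Fin.succAboveCases i with
  | x => simp [ins_same, ee]
  | p l => simp [ins_succAbove, ee]

lemma ins_LT' {n : ℕ} (i : Fin (n + 1)) (b : ℕ) {w v : Fin n → ℕ} (h : LT' w v) :
    LT' (ins i b w) (ins i b v) := by
  rw [LT'_iff] at *
  obtain ⟨k, h1, h2⟩ := h
  refine ⟨i.succAbove k, fun l hl => ?_, by simpa [ins_succAbove] using h2⟩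
  induction l using Fin.succAboveCases i with
  | x => simp [ins_same]
  | p l =>
    simp only [ins_succAbove]
    exact h1 l (by simpa using hl)

lemma ins_LT'_iff {n : ℕ} (i : Fin (n + 1)) (b : ℕ) {w v : Fin n → ℕ} :
    LT' (ins i b w) (ins i b v) ↔ LT' w v := by
  refine ⟨fun h => ?_, ins_LT' i b⟩
  rcases LT'.tri w v with h1 | rfl | h1
  · exact h1
  · exact absurd h (LT'.irrefl _)
  · exact absurd (h.trans (ins_LT' i b h1)) (LT'.irrefl _)

/-- slices -/
def sl {n : ℕ} (i : Fin (n + 1)) (b : ℕ) (A : Finset (Fin (n + 1) → ℕ)) : Finset (Fin n → ℕ) :=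
  A.preimage (ins i b) (fun _ _ _ _ h => (ins_inj.1 h).2)

lemma mem_sl {n : ℕ} {i : Fin (n + 1)} {b : ℕ} {A : Finset (Fin (n + 1) → ℕ)} {w : Fin n → ℕ} :
    w ∈ sl i b A ↔ ins i b w ∈ A := by
  unfold sl
  exact Finset.mem_preimage

lemma card_sl {n d : ℕ} (i : Fin (n + 1)) {A : Finset (Fin (n + 1) → ℕ)} (hA : A ⊆ DD (n + 1) d) :
    A.card = ∑ b ∈ Finset.range (d + 1), (sl i b A).card := by
  classical
  rw [Finset.card_eq_sum_card_fiberwise (f := fun u => u i) (t := Finset.range (d + 1))]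
  · refine Finset.sum_congr rfl fun b _ => ?_
    symm
    refine Finset.card_bij (fun w _ => ins i b w) ?_ ?_ ?_
    · intro w hw
      rw [mem_sl] at hw
      simp [hw, ins_same]
    · intro w _ v _ h
      exact (ins_inj.1 h).2
    · intro u hu
      rw [Finset.mem_filter] at hu
      obtain ⟨w, hw⟩ := ins_surj i u
      rw [hu.2] at hw
      exact ⟨w, by rw [mem_sl, ← hw]; exact hu.1, hw.symm⟩
  · intro u hu
    have := mem_DD.1 (hA hu)
    have h2 := Finset.single_le_sum (f := u) (fun _ _ => Nat.zero_le _) (Finset.mem_univ i)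
    simp
    omega

lemma sl_deg {n d : ℕ} (i : Fin (n + 1)) (b : ℕ) {A : Finset (Fin (n + 1) → ℕ)}
    (hA : A ⊆ DD (n + 1) d) : sl i b A ⊆ DD n (d - b) := by
  intro w hw
  have := mem_DD.1 (hA (mem_sl.1 hw))
  rw [sum_ins] at this
  rw [mem_DD]; omega

lemma sl_deg_le {n d : ℕ} {i : Fin (n + 1)} {b : ℕ} {A : Finset (Fin (n + 1) → ℕ)}
    (hA : A ⊆ DD (n + 1) d) {w : Fin n → ℕ} (hw : w ∈ sl i b A) : b ≤ d := by
  have := mem_DD.1 (hA (mem_sl.1 hw))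
  rw [sum_ins] at this
  omega

lemma sl_init {n d : ℕ} (i : Fin (n + 1)) (b : ℕ) {A : Finset (Fin (n + 1) → ℕ)}
    (hA : IsInit d A) : IsInit (d - b) (sl i b A) := by
  refine ⟨sl_deg i b hA.1, ?_⟩
  intro u hu v hv huv
  have hb := sl_deg_le hA.1 hu
  rw [mem_sl] at *
  refine hA.2 _ hu _ ?_ (ins_LT' i b huv)
  rw [mem_DD, sum_ins, mem_DD.1 hv]
  omega

lemma card_shad_SS {n : ℕ} {A : Finset (Fin (n + 1) → ℕ)} (hA : SS A) :
    (shad A).card + (sl (Fin.last n) 0 A).card = A.card := by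
  classical
  have h1 : (shad A).card = (A.filter (fun u => u (Fin.last n) ≠ 0)).card := by
    refine Finset.card_bij (fun w _ => w + ee (Fin.last n)) ?_ ?_ ?_
    · intro w hw
      rw [mem_shad] at hw
      obtain ⟨i, hi⟩ := hw
      rw [Finset.mem_filter]
      refine ⟨?_, by simp [ee]⟩
      rcases (Fin.le_last i).lt_or_eq with h | h
      · exact hA w i _ h hi
      · rw [← h]; exact hi
    · intro w _ v _ h
      exact add_left_injective _ h
    · intro u hu
      rw [Finset.mem_filter] at hu
      obtain ⟨w, hw⟩ := ins_surj (Fin.last n) u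
      obtain ⟨c, hc⟩ := Nat.exists_eq_succ_of_ne_zero hu.2
      have h2 : ins (Fin.last n) c w + ee (Fin.last n) = u := by
        rw [ins_add_same, hw, hc]
      exact ⟨ins (Fin.last n) c w, by rw [mem_shad]; exact ⟨_, by rw [h2]; exact hu.1⟩, h2⟩
  have h2 : (sl (Fin.last n) 0 A).card = (A.filter (fun u => ¬ u (Fin.last n) ≠ 0)).card := by
    refine Finset.card_bij (fun w _ => ins (Fin.last n) 0 w) ?_ ?_ ?_
    · intro w hw
      rw [mem_sl] at hw
      simp [hw, ins_same]
    · intro w _ v _ h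
      exact (ins_inj.1 h).2
    · intro u hu
      rw [Finset.mem_filter, not_not] at hu
      obtain ⟨w, hw⟩ := ins_surj (Fin.last n) u
      rw [hu.2] at hw
      exact ⟨w, by rw [mem_sl, ← hw]; exact hu.1, hw.symm⟩
  rw [h1, h2, Finset.card_filter_add_card_filter_not]

/-- Macaulay theorem in `n` variables (shadow form) -/
def Mac (n : ℕ) : Prop :=
  ∀ (d : ℕ) (A B : Finset (Fin n → ℕ)), A ⊆ DD n d → IsInit d B → B.card = A.card →
    (shad B).card ≤ (shad A).card

lemma Mac.le {n : ℕ} (hM : Mac n) {d : ℕ} {A B : Finset (Fin n → ℕ)} (hA : A ⊆ DD n d)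
    (hB : IsInit d B) (h : B.card ≤ A.card) : (shad B).card ≤ (shad A).card := by
  obtain ⟨B', hB', hc⟩ := exists_init n d A.card (Finset.card_le_card hA)
  have h1 : B ⊆ B' := init_subset hB hB' (by omega)
  exact (Finset.card_le_card (shad_mono h1)).trans (hM d A B' hA hB' hc)

lemma key_slice {n d b : ℕ} {v w : Fin (n + 1) → ℕ} (hv : ∑ i, v i = d)
    (hw : b + 1 + ∑ i, w i = d)
    (h : LT' (ins (Fin.last (n + 1)) (b + 1) w) (ins (Fin.last (n + 1)) 0 v)) :
    ins (Fin.last (n + 1)) b (w + ee (Fin.last n)) = ins (Fin.last (n + 1)) 0 v ∨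
    LT' (ins (Fin.last (n + 1)) b (w + ee (Fin.last n))) (ins (Fin.last (n + 1)) 0 v) := by
  rcases LT'.tri (ins (Fin.last (n + 1)) b (w + ee (Fin.last n))) (ins (Fin.last (n + 1)) 0 v)
    with h1 | h1 | h1
  · exact Or.inr h1
  · exact Or.inl h1
  exfalso
  obtain ⟨k, hk1, hk2⟩ := LT'_iff.1 h1
  have hlt : ∀ j : Fin (n + 1), (Fin.last (n + 1)).succAbove j < Fin.last (n + 1) := by
    intro j
    rw [Fin.succAbove_last]
    exact Fin.castSucc_lt_last j
  induction k using Fin.succAboveCases (Fin.last (n + 1)) with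
  | x =>
    rw [ins_same, ins_same] at hk2
    have h2 : v = w + ee (Fin.last n) := by
      funext j
      have := hk1 _ (hlt j)
      rwa [ins_succAbove, ins_succAbove] at this
    rw [h2, sum_add_ee] at hv
    omega
  | p l =>
    have hk3 : ∀ j, j < l → v j = (w + ee (Fin.last n)) j := by
      intro j hj
      have := hk1 ((Fin.last (n + 1)).succAbove j) (by simpa using hj)
      rwa [ins_succAbove, ins_succAbove] at this
    rw [ins_succAbove, ins_succAbove] at hk2
    have hk4 : ∀ j, j < l → v j = w j := by
      intro j hj
      have h3 : j ≠ Fin.last n := (hj.trans_le (Fin.le_last l)).ne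
      simpa [ee, h3] using hk3 j hj
    by_cases hl : l = Fin.last n
    · subst hl
      have : ∀ j, v j ≤ w j := by
        intro j
        rcases (Fin.le_last j).lt_or_eq with h3 | h3
        · exact (hk4 j h3).le
        · subst h3
          simp [ee] at hk2
          omega
      have := Finset.sum_le_sum (fun j (_ : j ∈ Finset.univ) => this j)
      omega
    · have h4 : v l < w l := by simpa [ee, hl] using hk2
      have h5 : LT' (ins (Fin.last (n + 1)) 0 v) (ins (Fin.last (n + 1)) (b + 1) w) := by
        rw [LT'_iff]
        refine ⟨(Fin.last (n + 1)).succAbove l, ?_, by rwa [ins_succAbove, ins_succAbove]⟩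
        intro j hj
        induction j using Fin.succAboveCases (Fin.last (n + 1)) with
        | x => exact absurd (hj.trans (hlt l)) (lt_irrefl _)
        | p j =>
          rw [ins_succAbove, ins_succAbove]
          exact hk4 j (by simpa using hj)
      exact LT'.irrefl _ (h.trans h5)

lemma mac_SS {n : ℕ} (hM : Mac (n + 1)) {d : ℕ} {A B : Finset (Fin (n + 2) → ℕ)}
    (hA : A ⊆ DD (n + 2) d) (hS : SS A) (hB : IsInit d B) (hc : B.card = A.card) :
    (shad B).card ≤ (shad A).card := by
  classical
  have h1 := card_shad_SS hS
  have h2 := card_shad_SS (init_SS hB)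
  suffices h : (sl (Fin.last (n + 1)) 0 A).card ≤ (sl (Fin.last (n + 1)) 0 B).card by omega
  by_contra hlt
  push Not at hlt
  have hSA := sl_deg (Fin.last (n + 1)) 0 hA
  obtain ⟨S, hSi, hSc⟩ := exists_init (n + 1) (d - 0) _ (Finset.card_le_card hSA)
  have hBi := sl_init (Fin.last (n + 1)) 0 hB
  have hnot : ¬ S ⊆ sl (Fin.last (n + 1)) 0 B := fun h => by
    have := Finset.card_le_card h
    omega
  obtain ⟨v, hvS, hvB⟩ := Finset.not_subset.1 hnot
  have hvd : ∑ i, v i = d := mem_DD.1 (hSi.1 hvS)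
  set V := ins (Fin.last (n + 1)) 0 v with hV
  have hVB : V ∉ B := fun h => hvB (mem_sl.2 h)
  have hVd : V ∈ DD (n + 2) d := by
    rw [mem_DD, hV, sum_ins, hvd, zero_add]
  set T := (DD (n + 2) d).filter (fun u => u = V ∨ LT' u V) with hT
  have hTi : IsInit d T := by
    refine ⟨Finset.filter_subset _ _, ?_⟩
    intro u hu x hx hxu
    rw [hT, Finset.mem_filter] at *
    refine ⟨hx, Or.inr ?_⟩
    rcases hu.2 with rfl | h
    · exact hxu
    · exact hxu.trans h
  have hBT : B ⊂ T := by
    rw [Finset.ssubset_iff_of_subset]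
    · exact ⟨V, by simp [hT, hVd], hVB⟩
    · intro u hu
      rw [hT, Finset.mem_filter]
      refine ⟨hB.1 hu, ?_⟩
      rcases LT'.tri u V with h | h | h
      · exact Or.inr h
      · exact Or.inl h
      · exact absurd (hB.2 u hu V hVd h) hVB
  have hcard := Finset.card_lt_card hBT
  have hsl : ∀ b, b ≤ d →
      (sl (Fin.last (n + 1)) b T).card ≤ (sl (Fin.last (n + 1)) b A).card := by
    intro b
    induction b with
    | zero =>
      intro _
      rw [← hSc]
      refine Finset.card_le_card ?_
      intro w hw
      have hw' := mem_sl.1 hw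
      rw [hT, Finset.mem_filter] at hw'
      rcases hw'.2 with h | h
      · rw [(ins_inj.1 h).2]; exact hvS
      · refine hSi.2 v hvS w ?_ ((ins_LT'_iff _ _).1 h)
        exact sl_deg _ 0 hTi.1 hw
    | succ b ih =>
      intro hb
      have h3 : sl (Fin.last (n + 1)) (b + 1) T ⊆ shad (sl (Fin.last (n + 1)) b T) := by
        intro w hw
        have hw' := mem_sl.1 hw
        rw [hT, Finset.mem_filter] at hw'
        rw [mem_shad]
        refine ⟨Fin.last n, ?_⟩
        have hd := mem_DD.1 hw'.1
        rw [sum_ins] at hd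
        rw [mem_sl, hT, Finset.mem_filter]
        refine ⟨?_, ?_⟩
        · rw [mem_DD, sum_ins, sum_add_ee]; omega
        · rcases hw'.2 with h | h
          · have := (ins_inj.1 h).1
            omega
          · exact key_slice hvd hd h
      have h4 : shad (sl (Fin.last (n + 1)) b A) ⊆ sl (Fin.last (n + 1)) (b + 1) A := by
        intro w hw
        rw [mem_shad] at hw
        obtain ⟨i, hi⟩ := hw
        rw [mem_sl, ← ins_add_succAbove] at hi
        rw [mem_sl, ← ins_add_same]
        refine hS _ _ _ ?_ hi
        rw [Fin.succAbove_last]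
        exact Fin.castSucc_lt_last i
      calc _ ≤ _ := Finset.card_le_card h3
        _ ≤ _ := hM.le (sl_deg _ b hA) (sl_init _ b hTi) (ih (by omega))
        _ ≤ _ := Finset.card_le_card h4
  have h5 := card_sl (Fin.last (n + 1)) hA
  have h6 := card_sl (Fin.last (n + 1)) hTi.1
  have h7 : ∑ b ∈ Finset.range (d + 1), (sl (Fin.last (n + 1)) b T).card ≤
      ∑ b ∈ Finset.range (d + 1), (sl (Fin.last (n + 1)) b A).card :=
    Finset.sum_le_sum fun b hb => hsl b (by simpa [Nat.lt_succ_iff] using hb)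
  omega

lemma sum_sl {n d : ℕ} (i : Fin (n + 1)) {A : Finset (Fin (n + 1) → ℕ)} (hA : A ⊆ DD (n + 1) d)
    (f : (Fin (n + 1) → ℕ) → ℕ) :
    ∑ u ∈ A, f u = ∑ b ∈ Finset.range (d + 1), ∑ w ∈ sl i b A, f (ins i b w) := by
  classical
  rw [← Finset.sum_fiberwise_of_maps_to (g := fun u => u i) (t := Finset.range (d + 1))]
  · refine Finset.sum_congr rfl fun b _ => ?_
    symm
    refine Finset.sum_bij (fun w _ => ins i b w) ?_ ?_ ?_ ?_
    · intro w hw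
      rw [mem_sl] at hw
      simp [hw, ins_same]
    · intro w _ v _ h
      exact (ins_inj.1 h).2
    · intro u hu
      rw [Finset.mem_filter] at hu
      obtain ⟨w, hw⟩ := ins_surj i u
      rw [hu.2] at hw
      exact ⟨w, by rw [mem_sl, ← hw]; exact hu.1, hw.symm⟩
    · intro _ _
      rfl
  · intro u hu
    have := mem_DD.1 (hA hu)
    have h2 := Finset.single_le_sum (f := u) (fun _ _ => Nat.zero_le _) (Finset.mem_univ i)
    simp
    omega

lemma init_sum_lt {n d : ℕ} {A B : Finset (Fin n → ℕ)} (hA : A ⊆ DD n d) (hB : IsInit d B)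
    (hc : B.card = A.card) (hne : B ≠ A) (r : (Fin n → ℕ) → ℕ)
    (hr : ∀ u ∈ DD n d, ∀ v ∈ DD n d, LT' u v → r u < r v) : ∑ u ∈ B, r u < ∑ u ∈ A, r u := by
  classical
  have h1 := Finset.sum_inter_add_sum_sdiff B A r
  have h2 := Finset.sum_inter_add_sum_sdiff A B r
  rw [Finset.inter_comm] at h2
  have hc2 : (B \ A).card = (A \ B).card := Finset.card_sdiff_comm hc
  have hn : (B \ A).Nonempty := by
    rw [Finset.nonempty_iff_ne_empty]
    intro h
    rw [Finset.sdiff_eq_empty_iff_subset] at h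
    exact hne (Finset.eq_of_subset_of_card_le h hc.ge)
  obtain ⟨x, hx, hmax⟩ := Finset.exists_max_image (B \ A) r hn
  have h3 : ∑ u ∈ B \ A, r u ≤ (B \ A).card • r x := Finset.sum_le_card_nsmul _ _ _ hmax
  have h4 : (A \ B).card • (r x + 1) ≤ ∑ u ∈ A \ B, r u := by
    refine Finset.card_nsmul_le_sum _ _ _ ?_
    intro y hy
    rw [Finset.mem_sdiff] at hx hy
    refine hr x (hB.1 hx.1) y (hA hy.1) ?_
    rcases LT'.tri x y with h | h | h
    · exact h
    · exact absurd (h ▸ hy.1) hx.2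
    · exact absurd (hB.2 x hx.1 y (hA hy.1) h) hy.2
  have h5 : 0 < (B \ A).card := Finset.card_pos.2 hn
  rw [← hc2] at h4
  simp only [smul_eq_mul] at h3 h4
  rw [mul_add] at h4
  omega

lemma exists_comp {n d : ℕ} (i : Fin (n + 1)) {A : Finset (Fin (n + 1) → ℕ)}
    (hA : A ⊆ DD (n + 1) d) : ∃ C : Finset (Fin (n + 1) → ℕ), C ⊆ DD (n + 1) d ∧
      ∀ b, IsInit (d - b) (sl i b C) ∧ (sl i b C).card = (sl i b A).card := by
  classical
  choose S hS hSc using fun b => exists_init n (d - b) _ (Finset.card_le_card (sl_deg i b hA))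
  refine ⟨(DD (n + 1) d).filter (fun u => i.removeNth u ∈ S (u i)), Finset.filter_subset _ _, ?_⟩
  intro b
  suffices h : sl i b ((DD (n + 1) d).filter (fun u => i.removeNth u ∈ S (u i))) = S b by
    rw [h]; exact ⟨hS b, hSc b⟩
  ext w
  rw [mem_sl, Finset.mem_filter, ins_same]
  have h1 : i.removeNth (ins i b w) = w := by simp [ins]
  rw [h1]
  refine ⟨fun h => h.2, fun h => ⟨?_, h⟩⟩
  have h2 := mem_DD.1 ((hS b).1 h)
  have h3 : b ≤ d := by
    have : 0 < (sl i b A).card := by rw [← hSc b]; exact Finset.card_pos.2 ⟨w, h⟩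
    obtain ⟨x, hx⟩ := Finset.card_pos.1 this
    exact sl_deg_le hA hx
  rw [mem_DD, sum_ins, h2]
  omega

lemma sl_shad {n : ℕ} (i : Fin (n + 1)) (b : ℕ) (A : Finset (Fin (n + 1) → ℕ)) :
    sl i b (shad A) = shad (sl i b A) ∪ sl i (b + 1) A := by
  classical
  ext w
  rw [Finset.mem_union, mem_sl, mem_shad, mem_shad, mem_sl, ← ins_add_same]
  constructor
  · rintro ⟨l, hl⟩
    induction l using Fin.succAboveCases i with
    | x => exact Or.inr hl
    | p l => exact Or.inl ⟨l, by rwa [mem_sl, ← ins_add_succAbove]⟩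
  · rintro (⟨l, hl⟩ | h)
    · exact ⟨i.succAbove l, by rwa [mem_sl, ← ins_add_succAbove] at hl⟩
    · exact ⟨i, h⟩

lemma comp_shad {n d : ℕ} (hM : Mac n) (i : Fin (n + 1)) {A C : Finset (Fin (n + 1) → ℕ)}
    (hA : A ⊆ DD (n + 1) d) (hC : C ⊆ DD (n + 1) d)
    (h : ∀ b, IsInit (d - b) (sl i b C) ∧ (sl i b C).card = (sl i b A).card) :
    (shad C).card ≤ (shad A).card := by
  classical
  rcases d with _ | d
  · rw [shad_zero hC]; simp
  rw [card_sl i (shad_deg hC), card_sl i (shad_deg hA)]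
  refine Finset.sum_le_sum fun b hb => ?_
  have hb : b ≤ d := by simpa [Nat.lt_succ_iff] using hb
  rw [sl_shad, sl_shad]
  have h1 : IsInit (d - b) (shad (sl i b C)) := by
    apply init_shad
    have := (h b).1
    rwa [show d + 1 - b = d - b + 1 by omega] at this
  have h2 : IsInit (d - b) (sl i (b + 1) C) := by
    have := (h (b + 1)).1
    rwa [show d + 1 - (b + 1) = d - b by omega] at this
  rcases le_total (shad (sl i b C)).card (sl i (b + 1) C).card with h3 | h3
  · rw [Finset.union_eq_right.2 (init_subset h1 h2 h3), (h (b + 1)).2]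
    exact Finset.card_le_card Finset.subset_union_right
  · rw [Finset.union_eq_left.2 (init_subset h2 h1 h3)]
    refine (hM _ _ _ (sl_deg i b hA) (h b).1 (h b).2).trans ?_
    exact Finset.card_le_card Finset.subset_union_left

lemma exists_SS {n d : ℕ} (hM : Mac (n + 2)) {A : Finset (Fin (n + 3) → ℕ)}
    (hA : A ⊆ DD (n + 3) d) : ∃ A', A' ⊆ DD (n + 3) d ∧ SS A' ∧ A'.card = A.card ∧
      (shad A').card ≤ (shad A).card := by
  classical
  set r : (Fin (n + 3) → ℕ) → ℕ := fun u => ((DD (n + 3) d).filter (fun v => LT' v u)).card with hr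
  set F := (DD (n + 3) d).powerset.filter
    (fun A' => A'.card = A.card ∧ (shad A').card ≤ (shad A).card) with hF
  obtain ⟨A', hA', hmin⟩ := Finset.exists_min_image F (fun A' => ∑ u ∈ A', r u)
    ⟨A, by simp [hF, hA]⟩
  simp only [hF, Finset.mem_filter, Finset.mem_powerset] at hA' hmin
  refine ⟨A', hA'.1, ?_, hA'.2⟩
  have hinit : ∀ i b, IsInit (d - b) (sl i b A') := by
    intro i
    obtain ⟨C, hC, hCs⟩ := exists_comp i hA'.1
    have h1 := comp_shad hM i hA'.1 hC hCs
    have h2 : C.card = A'.card := by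
      rw [card_sl i hC, card_sl i hA'.1]
      exact Finset.sum_congr rfl fun b _ => (hCs b).2
    have h3 := hmin C ⟨hC, h2.trans hA'.2.1, h1.trans hA'.2.2⟩
    by_contra hcon
    push Not at hcon
    obtain ⟨b, hb⟩ := hcon
    have hne : ∀ c, sl i c C ≠ sl i c A' → c ≤ d ∧ ∑ w ∈ sl i c C, r (ins i c w) <
        ∑ w ∈ sl i c A', r (ins i c w) := by
      intro c hc
      have hcd : c ≤ d := by
        by_contra hcd
        apply hc
        have e1 : sl i c C = ∅ := Finset.eq_empty_of_forall_notMem fun x hx =>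
          hcd (sl_deg_le hC hx)
        have e2 : sl i c A' = ∅ := Finset.eq_empty_of_forall_notMem fun x hx =>
          hcd (sl_deg_le hA'.1 hx)
        rw [e1, e2]
      refine ⟨hcd, ?_⟩
      refine init_sum_lt (sl_deg i c hA'.1) (hCs c).1 (hCs c).2 hc (fun w => r (ins i c w)) ?_
      intro u hu v hv huv
      have hd : ∀ x ∈ DD (n + 2) (d - c), ins i c x ∈ DD (n + 3) d := by
        intro x hx
        rw [mem_DD, sum_ins, mem_DD.1 hx]
        omega
      have huv' := ins_LT' i c huv
      simp only [hr]
      apply Finset.card_lt_card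
      rw [Finset.ssubset_iff_of_subset]
      · refine ⟨ins i c u, by simp [hd u hu, huv'], ?_⟩
        simp [LT'.irrefl]
      · intro x hx
        rw [Finset.mem_filter] at *
        exact ⟨hx.1, hx.2.trans huv'⟩
    have hbne : sl i b C ≠ sl i b A' := fun h => hb (h ▸ (hCs b).1)
    have h4 : ∑ u ∈ C, r u < ∑ u ∈ A', r u := by
      rw [sum_sl i hC, sum_sl i hA'.1]
      refine Finset.sum_lt_sum ?_ ⟨b, ?_, (hne b hbne).2⟩
      · intro c _
        by_cases hc : sl i c C = sl i c A'
        · rw [hc]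
        · exact (hne c hc).2.le
      · have := (hne b hbne).1
        simp
        omega
    exact absurd h3 (not_le.2 h4)
  intro w i j hij hw
  obtain ⟨l, hl⟩ : ∃ l : Fin (n + 3), l ∉ ({i, j} : Finset (Fin (n + 3))) := by
    by_contra hcon
    push Not at hcon
    have h1 : (Finset.univ : Finset (Fin (n + 3))) ⊆ {i, j} := fun x _ => hcon x
    have h2 := Finset.card_le_card h1
    have h3 := Finset.card_le_two (a := i) (b := j)
    simp only [Finset.card_univ, Fintype.card_fin] at h2
    omega
  simp only [Finset.mem_insert, Finset.mem_singleton, not_or] at hl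
  obtain ⟨i', rfl⟩ := Fin.exists_succAbove_eq (Ne.symm hl.1)
  obtain ⟨j', rfl⟩ := Fin.exists_succAbove_eq (Ne.symm hl.2)
  have hij' : i' < j' := by simpa using hij
  obtain ⟨x, hx⟩ := ins_surj l w
  rw [hx, ins_add_succAbove, ← mem_sl] at hw ⊢
  exact init_SS (hinit l _) x i' j' hij' hw

lemma mac_of_card_le_one {n : ℕ} (h : ∀ d, (DD n d).card ≤ 1) : Mac n := by
  intro d A B hA hB hc
  have : B = A := by
    rcases Nat.eq_zero_or_pos A.card with h0 | h0
    · rw [h0] at hc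
      rw [Finset.card_eq_zero.1 hc, Finset.card_eq_zero.1 h0]
    · have h1 := h d
      rw [Finset.eq_of_subset_of_card_le hA (by omega),
        Finset.eq_of_subset_of_card_le hB.1 (by omega)]
  rw [this]

lemma mac_zero : Mac 0 := mac_of_card_le_one fun d => by
  rw [Finset.card_le_one]
  intro a _ b _
  exact Subsingleton.elim _ _

lemma mac_one : Mac 1 := mac_of_card_le_one fun d => by
  rw [Finset.card_le_one]
  intro a ha b hb
  have h1 := mem_DD.1 ha
  have h2 := mem_DD.1 hb
  simp at h1 h2
  funext i
  fin_cases i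
  simp [h1, h2]

lemma mac_two : Mac 2 := by
  classical
  intro d A B hA hB hc
  by_cases hAD : A = DD 2 d
  · have : B = DD 2 d := Finset.eq_of_subset_of_card_le hB.1 (by rw [hc, hAD])
    rw [hAD, this]
  have h1 := card_shad_SS (init_SS hB)
  have h2 : ∃ z ∈ DD 2 d, z ∉ A := by
    by_contra hcon
    push Not at hcon
    exact hAD (Finset.Subset.antisymm hA hcon)
  obtain ⟨z, hz, hzA⟩ := h2
  have hz' := mem_DD.1 hz
  rw [Fin.sum_univ_two] at hz'
  suffices h : A.card ≤ (shad A).card by omega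
  refine Finset.card_le_card_of_injOn
    (fun u => if z 0 < u 0 then ![u 0 - 1, u 1] else ![u 0, u 1 - 1]) ?_ ?_
  · intro u hu
    have hu' := mem_DD.1 (hA hu)
    rw [Fin.sum_univ_two] at hu'
    have hne : u 0 ≠ z 0 := by
      intro h
      apply hzA
      have : z = u := by
        funext i
        fin_cases i
        · simp [h]
        · simp; omega
      rw [this]; exact hu
    simp only [SetLike.mem_coe]
    rw [mem_shad]
    split_ifs with h
    · refine ⟨0, ?_⟩
      have : ![u 0 - 1, u 1] + ee 0 = u := by
        funext i
        fin_cases i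
        · simp [ee]; omega
        · simp [ee]
      rw [this]; exact hu
    · refine ⟨1, ?_⟩
      have : ![u 0, u 1 - 1] + ee 1 = u := by
        funext i
        fin_cases i
        · simp [ee]
        · simp [ee]; omega
      rw [this]; exact hu
  · intro u hu v hv huv
    have hu' := mem_DD.1 (hA hu)
    rw [Fin.sum_univ_two] at hu'
    have hv' := mem_DD.1 (hA hv)
    rw [Fin.sum_univ_two] at hv'
    have hne : ∀ u ∈ A, u 0 = z 0 → False := by
      intro u hu h
      have hu' := mem_DD.1 (hA hu)
      rw [Fin.sum_univ_two] at hu'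
      apply hzA
      have : z = u := by
        funext i
        fin_cases i
        · simp [h]
        · simp; omega
      rw [this]; exact hu
    have hu2 : u 0 ≠ z 0 := fun h => hne u hu h
    have hv2 : v 0 ≠ z 0 := fun h => hne v hv h
    have e0 := congrFun huv 0
    have e1 := congrFun huv 1
    have key : u 0 = v 0 := by
      simp only at e0 e1
      split_ifs at e0 e1 <;> simp at e0 e1 <;> omega
    funext i
    fin_cases i
    · simpa using key
    · simp; omega

theorem macaulay (n : ℕ) : Mac n := by
  match n with
  | 0 => exact mac_zero
  | 1 => exact mac_one
  | 2 => exact mac_two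
  | n + 3 =>
    have ih := macaulay (n + 2)
    intro d A B hA hB hc
    obtain ⟨A', hA', hS, hc', hs⟩ := exists_SS ih hA
    exact (mac_SS ih hA' hS hB (hc.trans hc'.symm)).trans hs

lemma card_piAntidiag_nat {ι : Type*} [DecidableEq ι] (s : Finset ι) (n : ℕ) :
    (Finset.piAntidiag s n).card = (s.card + n - 1).choose n := by
  rw [← Finset.card_finsuppAntidiag_nat_eq_choose]
  simp [Finset.finsuppAntidiag]

lemma card_piAntidiag_nat' {ι : Type*} [DecidableEq ι] (s : Finset ι) (n : ℕ) (hs : 1 ≤ s.card) :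
    (Finset.piAntidiag s n).card = (n + s.card - 1).choose (s.card - 1) := by
  rw [card_piAntidiag_nat, show s.card + n - 1 = (s.card - 1) + n by omega,
    show n + s.card - 1 = (s.card - 1) + n by omega]
  exact Nat.choose_symm_add.symm

lemma card_DD (n j : ℕ) (hn : 1 ≤ n) : (DD n j).card = (j + n - 1).choose (n - 1) := by
  have := card_piAntidiag_nat' (Finset.univ : Finset (Fin n)) j (by simpa using hn)
  simpa [DD] using this

lemma binPoly_eval_one (l j : ℕ) (hl : 1 ≤ l) :
    (binPoly l 1).eval (j : ℚ) = ((j + l - 1).choose (l - 1) : ℕ) := by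
  rw [binPoly, Polynomial.eval_mul, Polynomial.eval_C, Polynomial.eval_prod]
  rw [Nat.choose_eq_descFactorial_div_factorial,
    Nat.cast_div (Nat.factorial_dvd_descFactorial _ _) (by positivity),
    Nat.descFactorial_eq_prod_range, one_div, mul_comm, div_eq_mul_inv]
  congr 1
  push_cast
  refine Finset.prod_congr rfl fun t ht => ?_
  have ht := Finset.mem_range.1 ht
  rw [Nat.cast_sub (by omega), Nat.cast_sub (by omega)]
  simp
  ring

lemma binPoly_succ (l i : ℕ) (x : ℚ) :
    (binPoly l (i + 1)).eval (x + 1) = (binPoly l i).eval x := by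
  simp only [binPoly, Polynomial.eval_mul, Polynomial.eval_C, Polynomial.eval_prod,
    Polynomial.eval_add, Polynomial.eval_X]
  congr 1
  refine Finset.prod_congr rfl fun t _ => ?_
  push_cast
  ring

/-- the polynomial attached to a sequence -/
def AP (r : ℕ) (l : ℕ → ℕ) : Polynomial ℚ := ∑ i ∈ Finset.Icc 1 r, binPoly (l i) i

lemma AP_zero (l : ℕ → ℕ) : AP 0 l = 0 := by simp [AP]

lemma AP_succ (r : ℕ) (l : ℕ → ℕ) (x : ℚ) : (AP (r + 1) l).eval (x + 1) =
    (binPoly (l 1) 1).eval (x + 1) + (AP r (fun i => l (i + 1))).eval x := by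
  induction r with
  | zero => simp [AP]
  | succ r ih =>
    have h1 : AP (r + 1 + 1) l = AP (r + 1) l + binPoly (l (r + 2)) (r + 2) := by
      simp only [AP]
      rw [Finset.sum_Icc_succ_top (by omega)]
    have h2 : AP (r + 1) (fun i => l (i + 1)) =
        AP r (fun i => l (i + 1)) + binPoly (l (r + 2)) (r + 1) := by
      simp only [AP]
      rw [Finset.sum_Icc_succ_top (by omega)]
    rw [h1, h2, Polynomial.eval_add, Polynomial.eval_add, ih, binPoly_succ (l (r + 2)) (r + 1), add_assoc]

/-- eventually given by an admissible polynomial -/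
def Adm (n : ℕ) (h : ℕ → ℕ) : Prop :=
  ∃ (r : ℕ) (l : ℕ → ℕ), AntitoneOn l (Set.Icc 1 r) ∧ (∀ i ∈ Set.Icc 1 r, 1 ≤ l i ∧ l i ≤ n) ∧
    ∃ j₀ : ℕ, ∀ j, j₀ ≤ j → (h j : ℚ) = (AP r l).eval (j : ℚ)

lemma Adm.mono {n n' : ℕ} {h : ℕ → ℕ} (hn : n ≤ n') (H : Adm n h) : Adm n' h := by
  obtain ⟨r, l, h1, h2, h3⟩ := H
  exact ⟨r, l, h1, fun i hi => ⟨(h2 i hi).1, (h2 i hi).2.trans hn⟩, h3⟩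

lemma Adm.of_zero {n : ℕ} {h : ℕ → ℕ} (j₀ : ℕ) (H : ∀ j, j₀ ≤ j → h j = 0) : Adm n h := by
  refine ⟨0, fun _ => 0, ?_, ?_, j₀, fun j hj => by rw [H j hj, AP_zero]; simp⟩
  · intro a ha
    simp only [Set.mem_Icc] at ha
    omega
  · intro a ha
    simp only [Set.mem_Icc] at ha
    omega

lemma Adm.congr {n : ℕ} {h h' : ℕ → ℕ} (j₁ : ℕ) (H : ∀ j, j₁ ≤ j → h' j = h j) (hh : Adm n h) :
    Adm n h' := by
  obtain ⟨r, l, h1, h2, j₀, h3⟩ := hh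
  refine ⟨r, l, h1, h2, max j₀ j₁, fun j hj => ?_⟩
  rw [H j (by omega), h3 j (by omega)]

lemma Adm.cons {n : ℕ} {h h' : ℕ → ℕ} (hh : Adm n h')
    (H : ∀ j, h (j + 1) = (DD n (j + 1)).card + h' j) : Adm n h := by
  obtain ⟨r, l, h1, h2, j₀, h3⟩ := hh
  rcases Nat.eq_zero_or_pos n with rfl | hn
  · have hr : r = 0 := by
      by_contra hr
      have := h2 1 (by simp only [Set.mem_Icc]; omega)
      omega
    subst hr
    refine Adm.of_zero (j₀ + 1) fun j hj => ?_
    obtain ⟨j, rfl⟩ : ∃ j', j = j' + 1 := ⟨j - 1, by omega⟩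
    have h4 := h3 j (by omega)
    rw [AP_zero, Polynomial.eval_zero] at h4
    rw [H, Nat.cast_eq_zero.1 h4, add_zero, Finset.card_eq_zero,
      Finset.eq_empty_iff_forall_notMem]
    intro u hu
    have := mem_DD.1 hu
    simp at this
  · refine ⟨r + 1, fun i => if i ≤ 1 then n else l (i - 1), ?_, ?_, j₀ + 1, ?_⟩
    · intro a ha b hb hab
      simp only [Set.mem_Icc] at ha hb
      dsimp only
      split_ifs with h5 h6
      · exact le_rfl
      · omega
      · exact (h2 (b - 1) (by simp only [Set.mem_Icc]; omega)).2
      · exact h1 (by simp only [Set.mem_Icc]; omega) (by simp only [Set.mem_Icc]; omega) (by omega)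
    · intro i hi
      simp only [Set.mem_Icc] at hi
      dsimp only
      split_ifs with h5
      · exact ⟨hn, le_rfl⟩
      · exact h2 (i - 1) (by simp only [Set.mem_Icc]; omega)
    · intro j hj
      obtain ⟨j, rfl⟩ : ∃ j', j = j' + 1 := ⟨j - 1, by omega⟩
      rw [H, card_DD n _ hn]
      push_cast
      rw [AP_succ, h3 j (by omega), if_pos le_rfl]
      have := binPoly_eval_one n (j + 1) hn
      push_cast at this
      rw [this]
      congr 2
      refine Finset.sum_congr rfl fun i hi => ?_
      rw [Finset.mem_Icc] at hi
      dsimp only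
      rw [if_neg (by omega)]
      simp

lemma exists_pred {n : ℕ} (u : Fin n → ℕ) (i : Fin n) (h : u i ≠ 0) : ∃ w, u = w + ee i := by
  refine ⟨u - ee i, ?_⟩
  funext j
  by_cases hj : j = i
  · subst hj; simp [ee]; omega
  · simp [ee, hj]

lemma lex_zero_case {n : ℕ}
    (IH : ∀ B : ℕ → Finset (Fin n → ℕ), (∀ j, IsInit j (B j)) → (∀ j, shad (B (j + 1)) ⊆ B j) →
      Adm n (fun j => (B j).card))
    (B : ℕ → Finset (Fin (n + 1) → ℕ)) (hB : ∀ j, IsInit j (B j))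
    (hs : ∀ j, shad (B (j + 1)) ⊆ B j) (j : ℕ) (w : Fin n → ℕ) (hw : w ∈ DD n j)
    (hwB : ins 0 0 w ∉ B j) : Adm n (fun j => (B j).card) := by
  classical
  have hz : ∀ k, ∀ u ∈ B (j + k), u 0 = 0 := by
    intro k
    induction k with
    | zero =>
      intro u hu
      by_contra h0
      apply hwB
      refine (hB j).2 u hu _ ?_ ?_
      · rw [mem_DD, sum_ins, mem_DD.1 hw, zero_add]
      · rw [LT'_iff]
        refine ⟨0, fun i hi => absurd hi (Fin.not_lt_zero i), ?_⟩
        rw [ins_same]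
        exact Nat.pos_of_ne_zero h0
    | succ k ih =>
      intro u hu
      by_contra h0
      obtain ⟨x, rfl⟩ := exists_pred u 0 h0
      have hx : x ∈ B (j + k) := hs _ (mem_shad.2 ⟨0, hu⟩)
      by_cases hx0 : x = 0
      · have hd := mem_DD.1 ((hB _).1 hx)
        rw [hx0] at hd
        simp at hd
        have hj : j = 0 := by omega
        have hk : k = 0 := by omega
        subst hj hk
        apply hwB
        have : ins 0 0 w = x := by
          have h1 : w = 0 := by
            have := mem_DD.1 hw
            rw [Finset.sum_eq_zero_iff] at this
            funext i
            exact this i (Finset.mem_univ _)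
          rw [hx0, h1]
          funext i
          induction i using Fin.succAboveCases 0 with
          | x => rw [ins_same]; rfl
          | p i => rw [ins_succAbove]; rfl
        rw [this]
        exact hx
      · obtain ⟨i, hi⟩ := Function.ne_iff.1 hx0
        obtain ⟨y, rfl⟩ := exists_pred x i hi
        have h2 : y + ee 0 ∈ B (j + k) := by
          refine hs _ (mem_shad.2 ⟨i, ?_⟩)
          rw [add_right_comm y (ee 0) (ee i)]; exact hu
        have := ih _ h2
        simp [ee] at this
  have h1 : Adm n (fun j => (sl 0 0 (B j)).card) := by
    refine IH _ (fun j => sl_init 0 0 (hB j)) fun j => ?_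
    intro x hx
    have h2 : x ∈ sl 0 0 (shad (B (j + 1))) := by
      rw [sl_shad]
      exact Finset.mem_union_left _ hx
    rw [mem_sl] at *
    exact hs j h2
  refine h1.congr j fun j' hj' => ?_
  obtain ⟨k, rfl⟩ := Nat.exists_eq_add_of_le hj'
  symm
  refine Finset.card_bij (fun w _ => ins 0 0 w) ?_ ?_ ?_
  · intro w hw
    exact mem_sl.1 hw
  · intro w _ v _ h
    exact (ins_inj.1 h).2
  · intro u hu
    obtain ⟨w, hw⟩ := ins_surj 0 u
    rw [hz k u hu] at hw
    exact ⟨w, by rw [mem_sl, ← hw]; exact hu, hw.symm⟩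

lemma lex_adm (n : ℕ) : ∀ B : ℕ → Finset (Fin n → ℕ), (∀ j, IsInit j (B j)) →
    (∀ j, shad (B (j + 1)) ⊆ B j) → Adm n (fun j => (B j).card) := by
  classical
  induction n with
  | zero =>
    intro B hB _
    refine Adm.of_zero 1 fun j hj => ?_
    rw [Finset.card_eq_zero, Finset.eq_empty_iff_forall_notMem]
    intro u hu
    have := mem_DD.1 ((hB j).1 hu)
    simp at this
    omega
  | succ n IH =>
    intro B hB hs
    by_cases hall : ∀ j, B j = DD (n + 1) j
    · refine ⟨1, fun _ => n + 1, fun _ _ _ _ _ => le_rfl, fun i _ => ⟨Nat.succ_pos n, le_rfl⟩, 0, ?_⟩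
      intro j _
      dsimp only
      rw [hall, card_DD _ _ (by omega), ← binPoly_eval_one _ _ (by omega)]
      simp [AP]
    refine Adm.mono (Nat.le_succ n) ?_
    push Not at hall
    obtain ⟨j, hj⟩ := hall
    have h2 : ∃ z ∈ DD (n + 1) j, z ∉ B j := by
      by_contra hcon
      push Not at hcon
      exact hj (Finset.Subset.antisymm (hB j).1 hcon)
    clear hj
    obtain ⟨z, hz, hzB⟩ := h2
    obtain ⟨a, ha⟩ : ∃ a, a = z 0 := ⟨_, rfl⟩
    induction a generalizing B j z with
    | zero =>
      obtain ⟨w, hw⟩ := ins_surj 0 z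
      rw [← ha] at hw
      refine lex_zero_case IH B hB hs j w ?_ (hw ▸ hzB)
      have := mem_DD.1 hz
      rw [hw, sum_ins] at this
      rw [mem_DD]; omega
    | succ a ih =>
      by_cases hex : ∃ j, ∃ w ∈ DD n j, ins 0 0 w ∉ B j
      · obtain ⟨j', w, hw, hwB⟩ := hex
        exact lex_zero_case IH B hB hs j' w hw hwB
      push Not at hex
      set B' : ℕ → Finset (Fin (n + 1) → ℕ) :=
        fun j => (B (j + 1)).preimage (fun w => w + ee 0) (add_left_injective _).injOn with hB'
      have hmem : ∀ j u, u ∈ B' j ↔ u + ee 0 ∈ B (j + 1) := by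
        intro j u
        simp only [hB', Finset.mem_preimage]
      have hB'i : ∀ j, IsInit j (B' j) := by
        intro j
        refine ⟨?_, ?_⟩
        · intro u hu
          have := mem_DD.1 ((hB _).1 ((hmem _ _).1 hu))
          rw [sum_add_ee] at this
          rw [mem_DD]; omega
        · intro u hu v hv huv
          rw [hmem] at *
          refine (hB _).2 _ hu _ ?_ (huv.add _)
          rw [mem_DD, sum_add_ee, mem_DD.1 hv]
      have hB's : ∀ j, shad (B' (j + 1)) ⊆ B' j := by
        intro j w hw
        obtain ⟨i, hi⟩ := mem_shad.1 hw
        rw [hmem] at *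
        refine hs _ (mem_shad.2 ⟨i, ?_⟩)
        rw [add_right_comm w (ee 0) (ee i)]; exact hi
      obtain ⟨x, rfl⟩ := exists_pred z 0 (by omega)
      have hzd := mem_DD.1 hz
      rw [sum_add_ee] at hzd
      obtain ⟨j, rfl⟩ : ∃ j', j = j' + 1 := ⟨j - 1, by omega⟩
      have hadm := ih B' hB'i hB's j x (by rw [mem_DD]; omega) (fun h => hzB ((hmem _ _).1 h))
        (by simp [ee] at ha; omega)
      refine hadm.cons fun j => ?_
      rw [← Finset.card_filter_add_card_filter_not (s := B (j + 1)) (fun u => u 0 = 0)]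
      congr 1
      · symm
        refine Finset.card_bij (fun w _ => ins 0 0 w) ?_ ?_ ?_
        · intro w hw
          rw [Finset.mem_filter, ins_same]
          exact ⟨hex _ _ hw, rfl⟩
        · intro w _ v _ h
          exact (ins_inj.1 h).2
        · intro u hu
          rw [Finset.mem_filter] at hu
          obtain ⟨w, hw⟩ := ins_surj 0 u
          rw [hu.2] at hw
          refine ⟨w, ?_, hw.symm⟩
          have := mem_DD.1 ((hB _).1 hu.1)
          rw [hw, sum_ins] at this
          rw [mem_DD]; omega
      · symm
        refine Finset.card_bij (fun w _ => w + ee 0) ?_ ?_ ?_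
        · intro w hw
          rw [Finset.mem_filter]
          exact ⟨(hmem _ _).1 hw, by simp [ee]⟩
        · intro w _ v _ h
          exact add_left_injective _ h
        · intro u hu
          rw [Finset.mem_filter] at hu
          obtain ⟨w, rfl⟩ := exists_pred u 0 hu.2
          exact ⟨w, (hmem _ _).2 hu.1, rfl⟩

theorem adm_of_order_ideal (n : ℕ) (N : ℕ → Finset (Fin n → ℕ)) (hN : ∀ j, N j ⊆ DD n j)
    (hs : ∀ j, shad (N (j + 1)) ⊆ N j) : Adm n (fun j => (N j).card) := by
  choose B hB hc using fun j => exists_init n j _ (Finset.card_le_card (hN j))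
  have h := lex_adm n B hB (fun j => by
    refine init_subset (init_shad (hB (j + 1))) (hB j) ?_
    refine (macaulay n _ _ _ (hN (j + 1)) (hB (j + 1)) (hc _)).trans ?_
    rw [hc]
    exact Finset.card_le_card (hs j))
  simpa only [hc] using h


open Classical in
theorem exists_order_ideal (m : ℕ) : ∀ (r : ℕ) (l : ℕ → ℕ) (M : ℕ), AntitoneOn l (Set.Icc 1 r) →
    (∀ i ∈ Set.Icc 1 r, 1 ≤ l i ∧ l i ≤ M) → M ≤ m →
    ∃ N : Set (Fin (m + 1) → ℕ), (∀ w i, w + ee i ∈ N → w ∈ N) ∧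
      (∀ u ∈ N, ∀ i : Fin (m + 1), (i : ℕ) < m - M → u i = 0) ∧
      ∃ j₀ : ℕ, ∀ j, j₀ ≤ j → (((DD (m + 1) j).filter (· ∈ N)).card : ℚ) =
        (AP r l).eval (j : ℚ) := by
  intro r
  induction r with
  | zero =>
    intro l M _ _ _
    exact ⟨∅, by simp, by simp, 0, fun j _ => by simp [AP_zero]⟩
  | succ r ih =>
    intro l M hl hb hM
    have h1 := hb 1 (by simp only [Set.mem_Icc]; omega)
    obtain ⟨N', hN1, hN2, j₀, hN3⟩ := ih (fun i => l (i + 1)) (l 1)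
      (by
        intro a ha b hb hab
        simp only [Set.mem_Icc] at ha hb
        exact hl (by simp only [Set.mem_Icc]; omega) (by simp only [Set.mem_Icc]; omega) (by omega))
      (by
        intro i hi
        simp only [Set.mem_Icc] at hi
        refine ⟨(hb (i + 1) (by simp only [Set.mem_Icc]; omega)).1, ?_⟩
        exact hl (by simp only [Set.mem_Icc]; omega) (by simp only [Set.mem_Icc]; omega) (by omega))
      (by omega)
    obtain ⟨a, ha⟩ : ∃ a : Fin (m + 1), (a : ℕ) = m - l 1 := ⟨⟨m - l 1, by omega⟩, rfl⟩
    have key : ∀ v ∈ N', (∀ i ≤ a, v i = 0) ∨ ∃ v' ∈ N', v = v' + ee a := by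
      intro v hv
      by_cases h0 : v a = 0
      · left
        intro i hi
        rcases hi.lt_or_eq with h | rfl
        · refine hN2 v hv i ?_
          rw [← ha]; exact h
        · exact h0
      · right
        obtain ⟨v', rfl⟩ := exists_pred v a h0
        exact ⟨v', hN1 _ _ hv, rfl⟩
    refine ⟨{u | (∀ i ≤ a, u i = 0) ∨ ∃ v ∈ N', u = v + ee a}, ?_, ?_, j₀ + 1, ?_⟩
    · intro w i hw
      rcases hw with hw | ⟨v, hv, hw⟩
      · left
        intro i' hi'
        have := hw i' hi'
        simp at this
        exact this.1
      · by_cases hia : i = a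
        · subst hia
          have := add_right_cancel hw
          subst this
          exact key _ hv
        · by_cases hvi : v i = 0
          · exfalso
            have := congrFun hw i
            simp [ee, hia, hvi] at this
          · obtain ⟨v', rfl⟩ := exists_pred v i hvi
            right
            refine ⟨v', hN1 _ _ hv, ?_⟩
            rw [add_right_comm v'] at hw
            exact add_right_cancel hw
    · intro u hu i hi
      have hia : i < a := by
        rw [Fin.lt_def, ha]; omega
      rcases hu with hu | ⟨v, hv, rfl⟩
      · exact hu i hia.le
      · have := hN2 v hv i (by rw [← ha]; exact hia)
        simp [ee, hia.ne, this]
    · intro j hj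
      obtain ⟨j, rfl⟩ : ∃ j', j = j' + 1 := ⟨j - 1, by omega⟩
      push_cast
      rw [AP_succ, ← hN3 j (by omega)]
      have hbp := binPoly_eval_one (l 1) (j + 1) h1.1
      push_cast at hbp
      have hcard : (Finset.Ioi a).card = l 1 := by
        rw [Fin.card_Ioi]; omega
      have h5 := card_piAntidiag_nat' (Finset.Ioi a) (j + 1) (by omega)
      rw [hcard] at h5
      rw [hbp, ← h5]
      norm_cast
      rw [← Finset.card_filter_add_card_filter_not (fun u => u a = 0)]
      congr 1
      · congr 1
        ext u
        simp only [Finset.mem_filter, Finset.mem_piAntidiag, mem_DD, Set.mem_ofPred_eq, Finset.mem_Ioi]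
        constructor
        · rintro ⟨⟨hs, hu⟩, hu0⟩
          rcases hu with hu | ⟨v, hv, rfl⟩
          · refine ⟨?_, ?_⟩
            · rw [← hs]
              refine Finset.sum_subset (Finset.subset_univ _) ?_
              intro x _ hx
              refine hu x ?_
              simpa using hx
            · intro i hi
              by_contra hcon
              exact hi (hu i (not_lt.1 hcon))
          · simp [ee] at hu0
        · rintro ⟨hs, hu⟩
          have h7 : ∀ i ≤ a, u i = 0 := by
            intro i hi
            by_contra hcon
            exact absurd (hu i hcon) (not_lt.2 hi)
          refine ⟨⟨?_, Or.inl h7⟩, h7 a le_rfl⟩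
          rw [← hs]
          symm
          refine Finset.sum_subset (Finset.subset_univ _) ?_
          intro x _ hx
          refine h7 x ?_
          simpa using hx
      · symm
        refine Finset.card_bij (fun w _ => w + ee a) ?_ ?_ ?_
        · intro w hw
          simp only [Finset.mem_filter, mem_DD] at hw ⊢
          refine ⟨⟨?_, Or.inr ⟨w, hw.2, rfl⟩⟩, by simp [ee]⟩
          rw [sum_add_ee, hw.1]
        · intro w _ v _ h
          exact add_left_injective _ h
        · intro u hu
          simp only [Finset.mem_filter, mem_DD] at hu
          rcases hu.1.2 with h | ⟨v, hv, rfl⟩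
          · exact absurd (h a le_rfl) hu.2
          · refine ⟨v, ?_, rfl⟩
            have := hu.1.1
            rw [sum_add_ee] at this
            simp only [Finset.mem_filter, mem_DD]
            exact ⟨by omega, hv⟩

open Classical in
lemma greedy {K V ι : Type*} [Field K] [AddCommGroup V] [Module K V] [LinearOrder ι] (e : ι → V)
    (s : Finset ι) : Module.finrank K (Submodule.span K (e '' (s : Set ι))) =
      (s.filter (fun a => e a ∉ Submodule.span K (e '' {b | b ∈ s ∧ b < a}))).card := by
  induction s using Finset.induction_on_max with
  | empty => rw [Finset.coe_empty, Set.image_empty, Submodule.span_empty, finrank_bot]; simp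
  | insert a s ha ih =>
    have has : a ∉ s := fun h => lt_irrefl _ (ha a h)
    have h1 : {b | b ∈ insert a s ∧ b < a} = (s : Set ι) := by
      ext b
      simp only [Finset.mem_insert, Set.mem_ofPred_eq, Finset.mem_coe]
      constructor
      · rintro ⟨rfl | h, h'⟩
        · exact absurd h' (lt_irrefl _)
        · exact h
      · intro h
        exact ⟨Or.inr h, ha b h⟩
    have h2 : ∀ c ∈ s, {b | b ∈ insert a s ∧ b < c} = {b | b ∈ s ∧ b < c} := by
      intro c hc
      ext b
      simp only [Finset.mem_insert, Set.mem_ofPred_eq]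
      constructor
      · rintro ⟨rfl | h, h'⟩
        · exact absurd (h'.trans (ha c hc)) (lt_irrefl _)
        · exact ⟨h, h'⟩
      · rintro ⟨h, h'⟩
        exact ⟨Or.inr h, h'⟩
    have h3 : s.filter (fun c => e c ∉ Submodule.span K (e '' {b | b ∈ insert a s ∧ b < c})) =
        s.filter (fun c => e c ∉ Submodule.span K (e '' {b | b ∈ s ∧ b < c})) := by
      refine Finset.filter_congr fun c hc => ?_
      rw [h2 c hc]
    rw [Finset.filter_insert, h3, h1, Finset.coe_insert, Set.image_insert_eq]
    rw [ite_not]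
    split_ifs with h4
    · rw [Submodule.span_insert_eq_span h4, ih]
    · rw [Finset.card_insert_of_notMem (fun h => has (Finset.mem_filter.1 h).1), ← ih, Submodule.span_insert]
      have : FiniteDimensional K (Submodule.span K (e '' (s : Set ι))) :=
        FiniteDimensional.span_of_finite K (s.finite_toSet.image e)
      have h5 := Submodule.finrank_sup_add_finrank_inf_eq (Submodule.span K {e a})
        (Submodule.span K (e '' (s : Set ι)))
      have h6 : e a ≠ 0 := by
        intro h
        rw [h] at h4
        exact h4 (Submodule.zero_mem _)
      have h7 : Submodule.span K {e a} ⊓ Submodule.span K (e '' (s : Set ι)) = ⊥ := by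
        rw [← disjoint_iff]
        exact (Submodule.disjoint_span_singleton' h6).2 h4 |>.symm
      rw [h7, finrank_bot, finrank_span_singleton h6] at h5
      omega

/-- class of the monomial -/
def ec (k : Type*) [Field k] (m : ℕ) (I : Ideal (MvPolynomial (Fin (m + 1)) k))
    (u : Fin (m + 1) → ℕ) : MvPolynomial (Fin (m + 1)) k ⧸ I :=
  Ideal.Quotient.mkₐ k I (monomial (Finsupp.equivFunOnFinite.symm u) 1)

lemma gradedPiece_eq (k : Type*) [Field k] (m : ℕ) (I : Ideal (MvPolynomial (Fin (m + 1)) k))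
    (j : ℕ) : gradedPiece k m I j = Submodule.span k (ec k m I '' (DD (m + 1) j : Set _)) := by
  have h1 : homogeneousSubmodule (Fin (m + 1)) k j = Submodule.span k
      ((fun u : Fin (m + 1) → ℕ =>
        (monomial (Finsupp.equivFunOnFinite.symm u) (1 : k))) '' (DD (m + 1) j : Set _)) := by
    apply le_antisymm
    · intro f hf
      rw [f.as_sum]
      refine Submodule.sum_mem _ fun d hd => ?_
      have : monomial d (coeff d f) = coeff d f • (monomial d (1 : k)) := by
        rw [smul_monomial, smul_eq_mul, mul_one]
      rw [this]
      refine Submodule.smul_mem _ _ (Submodule.subset_span ⟨d, ?_, ?_⟩)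
      · have := (mem_homogeneousSubmodule j f).1 hf (mem_support_iff.1 hd)
        rw [Finset.mem_coe, mem_DD, ← this, Finsupp.weight_apply,
          Finsupp.sum_fintype _ _ (by simp)]
        simp
      · have h2 : Finsupp.equivFunOnFinite.symm (d : Fin (m + 1) → ℕ) = d := by
          ext i
          rfl
        dsimp only
        rw [h2]
    · rw [Submodule.span_le]
      rintro _ ⟨u, hu, rfl⟩
      have hu := mem_DD.1 (Finset.mem_coe.1 hu)
      rw [SetLike.mem_coe, mem_homogeneousSubmodule]
      apply isHomogeneous_monomial
      rw [← hu, Finsupp.degree_eq_sum]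
      rfl
  rw [gradedPiece, h1, Submodule.map_span, ← Set.image_comp]
  rfl

open Classical in
/-- standard monomials -/
def stdm (k : Type*) [Field k] (m : ℕ) (I : Ideal (MvPolynomial (Fin (m + 1)) k)) (j : ℕ) :
    Finset (Fin (m + 1) → ℕ) :=
  (DD (m + 1) j).filter (fun u =>
    ec k m I u ∉ Submodule.span k (ec k m I '' {v | v ∈ DD (m + 1) j ∧ LT' v u}))

lemma hdim_eq (k : Type*) [Field k] (m : ℕ) (I : Ideal (MvPolynomial (Fin (m + 1)) k)) (j : ℕ) :
    hdim k m I j = (stdm k m I j).card := by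
  rw [hdim, gradedPiece_eq]
  exact greedy (K := k) (ι := Lex (Fin (m + 1) → ℕ)) (ec k m I) (DD (m + 1) j)

lemma ec_add (k : Type*) [Field k] (m : ℕ) (I : Ideal (MvPolynomial (Fin (m + 1)) k))
    (u v : Fin (m + 1) → ℕ) : ec k m I (u + v) = ec k m I v * ec k m I u := by
  rw [ec, ec, ec, ← map_mul, monomial_mul, one_mul, add_comm u v]
  have h : Finsupp.equivFunOnFinite.symm (v + u) =
      Finsupp.equivFunOnFinite.symm v + Finsupp.equivFunOnFinite.symm u := by
    ext i
    rfl
  rw [h]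

lemma stdm_shad (k : Type*) [Field k] (m : ℕ) (I : Ideal (MvPolynomial (Fin (m + 1)) k)) (j : ℕ) :
    shad (stdm k m I (j + 1)) ⊆ stdm k m I j := by
  classical
  intro w hw
  obtain ⟨i, hi⟩ := mem_shad.1 hw
  rw [stdm, Finset.mem_filter] at hi ⊢
  have hd := mem_DD.1 hi.1
  rw [sum_add_ee] at hd
  refine ⟨by rw [mem_DD]; omega, fun hcon => hi.2 ?_⟩
  rw [ec_add]
  have h1 := Submodule.mem_map_of_mem (f := LinearMap.mulLeft k (ec k m I (ee i))) hcon
  rw [Submodule.map_span, LinearMap.mulLeft_apply] at h1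
  refine Submodule.span_mono ?_ h1
  rintro _ ⟨_, ⟨v, hv, rfl⟩, rfl⟩
  refine ⟨v + ee i, ⟨?_, hv.2.add _⟩, ?_⟩
  · rw [mem_DD, sum_add_ee, mem_DD.1 hv.1]
  · rw [ec_add]; rfl

/-- the monomial ideal with given standard monomials -/
def monIdeal (k : Type*) [Field k] (m : ℕ) (N : Set (Fin (m + 1) → ℕ))
    (hN : ∀ w i, w + ee i ∈ N → w ∈ N) : Ideal (MvPolynomial (Fin (m + 1)) k) where
  carrier := {f | ∀ d ∈ f.support, (d : Fin (m + 1) → ℕ) ∉ N}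
  zero_mem' := by simp
  add_mem' := by
    classical
    intro f g hf hg d hd
    rcases Finset.mem_union.1 (support_add hd) with h | h
    · exact hf d h
    · exact hg d h
  smul_mem' := by
    classical
    intro c f hf d hd
    rw [smul_eq_mul] at hd
    obtain ⟨a, ha, b, hb, rfl⟩ := Finset.mem_add.1 (support_mul c f hd)
    have key : ∀ (s : ℕ) (x y : Fin (m + 1) → ℕ), ∑ i, x i = s → x + y ∈ N → y ∈ N := by
      intro s
      induction s with
      | zero =>
        intro x y hx hy
        have : x = 0 := by
          rw [Finset.sum_eq_zero_iff] at hx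
          funext i
          exact hx i (Finset.mem_univ _)
        rwa [this, zero_add] at hy
      | succ s ih =>
        intro x y hx hy
        have h0 : x ≠ 0 := by
          rintro rfl
          simp at hx
        obtain ⟨i, hi⟩ := Function.ne_iff.1 h0
        obtain ⟨x', rfl⟩ := exists_pred x i hi
        rw [sum_add_ee] at hx
        refine ih x' y (by omega) (hN _ i ?_)
        rwa [add_right_comm x'] at hy
    intro hcon
    rw [Finsupp.coe_add] at hcon
    exact hf b hb (key _ _ _ rfl hcon)

lemma mem_monIdeal {k : Type*} [Field k] {m : ℕ} {N : Set (Fin (m + 1) → ℕ)}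
    {hN : ∀ w i, w + ee i ∈ N → w ∈ N} {f : MvPolynomial (Fin (m + 1)) k} :
    f ∈ monIdeal k m N hN ↔ ∀ d ∈ f.support, (d : Fin (m + 1) → ℕ) ∉ N := Iff.rfl

open Classical in
lemma stdm_monIdeal (k : Type*) [Field k] (m : ℕ) (N : Set (Fin (m + 1) → ℕ))
    (hN : ∀ w i, w + ee i ∈ N → w ∈ N) (j : ℕ) :
    stdm k m (monIdeal k m N hN) j = (DD (m + 1) j).filter (· ∈ N) := by
  refine Finset.filter_congr fun u hu => ?_
  constructor
  · intro h
    by_contra hcon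
    apply h
    have : ec k m (monIdeal k m N hN) u = 0 := by
      rw [ec, Ideal.Quotient.mkₐ_eq_mk, Ideal.Quotient.eq_zero_iff_mem, mem_monIdeal]
      intro d hd
      rw [Finset.mem_singleton.1 (support_monomial_subset hd)]
      exact hcon
    rw [this]
    exact Submodule.zero_mem _
  · intro huN hcon
    have h1 : ec k m (monIdeal k m N hN) '' {v | v ∈ DD (m + 1) j ∧ LT' v u} =
        (Ideal.Quotient.mkₐ k (monIdeal k m N hN)).toLinearMap ''
        ((fun v : Fin (m + 1) → ℕ => monomial (Finsupp.equivFunOnFinite.symm v) (1 : k)) ''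
          {v | v ∈ DD (m + 1) j ∧ LT' v u}) := by
      rw [← Set.image_comp]; rfl
    rw [h1, ← Submodule.map_span] at hcon
    obtain ⟨g, hg, hgu⟩ := hcon
    have h2 : coeff (Finsupp.equivFunOnFinite.symm u) g = 0 := by
      have : Submodule.span k ((fun v : Fin (m + 1) → ℕ =>
          monomial (Finsupp.equivFunOnFinite.symm v) (1 : k)) ''
          {v | v ∈ DD (m + 1) j ∧ LT' v u}) ≤
          LinearMap.ker (lcoeff k (Finsupp.equivFunOnFinite.symm u)) := by
        rw [Submodule.span_le]
        rintro _ ⟨v, hv, rfl⟩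
        rw [SetLike.mem_coe, LinearMap.mem_ker, lcoeff_apply, coeff_monomial, if_neg]
        intro h
        have := Finsupp.equivFunOnFinite.symm.injective h
        rw [this] at hv
        exact LT'.irrefl _ hv.2
      exact this hg
    have h3 : g - monomial (Finsupp.equivFunOnFinite.symm u) 1 ∈ monIdeal k m N hN := by
      rw [← Ideal.Quotient.eq]
      exact hgu
    refine mem_monIdeal.1 h3 (Finsupp.equivFunOnFinite.symm u) ?_ huN
    rw [mem_support_iff, coeff_sub, h2, coeff_monomial, if_pos rfl]
    simp

lemma binPoly_degree_lead (l i : ℕ) : (binPoly l i).natDegree = l - 1 ∧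
    0 < (binPoly l i).leadingCoeff := by
  have hm : (∏ t ∈ Finset.range (l - 1),
      (Polynomial.X + Polynomial.C ((l : ℚ) - (i : ℚ) - (t : ℚ)))).Monic :=
    Polynomial.monic_prod_of_monic _ _ fun t _ => Polynomial.monic_X_add_C _
  have h0 : (1 / (Nat.factorial (l - 1) : ℚ)) ≠ 0 := by positivity
  constructor
  · rw [binPoly, Polynomial.natDegree_C_mul h0,
      Polynomial.natDegree_prod_of_monic _ _ fun t _ => Polynomial.monic_X_add_C _]
    simp only [Polynomial.natDegree_X_add_C, Finset.sum_const, Finset.card_range, smul_eq_mul,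
      mul_one]
  · rw [binPoly, Polynomial.leadingCoeff_mul, hm.leadingCoeff, Polynomial.leadingCoeff_C]
    positivity

lemma binPoly_coeff_nonneg (l i n : ℕ) (h : l - 1 ≤ n) : 0 ≤ (binPoly l i).coeff n := by
  have h1 := binPoly_degree_lead l i
  rcases h.lt_or_eq with h | h
  · rw [Polynomial.coeff_eq_zero_of_natDegree_lt (by omega)]
  · rw [← h, ← h1.1]
    exact h1.2.le

lemma le_of_degree {m r : ℕ} {l : ℕ → ℕ} (hl : AntitoneOn l (Set.Icc 1 r))
    (h1 : ∀ i ∈ Set.Icc 1 r, 1 ≤ l i) (hd : (AP r l).degree < (m : ℕ)) :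
    ∀ i ∈ Set.Icc 1 r, l i ≤ m := by
  intro i hi
  have hi' : 1 ≤ i ∧ i ≤ r := hi
  have hmem : 1 ∈ Set.Icc 1 r := by simp only [Set.mem_Icc]; omega
  refine (hl hmem hi hi'.1).trans ?_
  by_contra hcon
  have h2 : (AP r l).coeff (l 1 - 1) = 0 := by
    apply Polynomial.coeff_eq_zero_of_degree_lt
    refine hd.trans_le ?_
    exact_mod_cast (by omega : m ≤ l 1 - 1)
  have h3 : 0 < (AP r l).coeff (l 1 - 1) := by
    rw [AP, Polynomial.finsetSum_coeff]
    refine Finset.sum_pos' ?_ ⟨1, by rw [Finset.mem_Icc]; omega, ?_⟩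
    · intro i hi
      rw [Finset.mem_Icc] at hi
      refine binPoly_coeff_nonneg _ _ _ ?_
      have := hl hmem (show i ∈ Set.Icc 1 r from hi) hi.1
      omega
    · have h4 := binPoly_degree_lead (l 1) 1
      rw [Polynomial.leadingCoeff, h4.1] at h4
      exact h4.2
  exact absurd h2 (ne_of_gt h3)

/-- For a polynomial `p ∈ ℚ[t]` of degree `< m`, the following are equivalent:
(a) there are a homogeneous ideal `I ⊆ R` and an integer `j₀` with `dim_k (R/I)_j = p(j)` for
all `j ≥ j₀`; (b) there are `r ≥ 0` and integers `λ_1 ≥ λ_2 ≥ ⋯ ≥ λ_r ≥ 1` with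
`p(t) = Σ_{i=1}^{r} C(t + λ_i − i, λ_i − 1)` in `ℚ[t]`. -/
theorem hilbert_polynomial_characterization (k : Type*) [Field k] (m : ℕ) (hm : 1 ≤ m)
    (p : Polynomial ℚ) (hdeg : p.degree < (m : ℕ)) :
    (∃ I : Ideal (MvPolynomial (Fin (m + 1)) k),
        (∀ f ∈ I, ∀ n : ℕ, homogeneousComponent n f ∈ I) ∧
        ∃ j₀ : ℕ, ∀ j : ℕ, j₀ ≤ j → (hdim k m I j : ℚ) = p.eval (j : ℚ)) ↔
    (∃ (r : ℕ) (l : ℕ → ℕ), AntitoneOn l (Set.Icc 1 r) ∧ (∀ i ∈ Set.Icc 1 r, 1 ≤ l i) ∧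
        p = ∑ i ∈ Finset.Icc 1 r, binPoly (l i) i) := by
  constructor
  · rintro ⟨I, -, j₀, hI⟩
    obtain ⟨r, l, h1, h2, j₁, h3⟩ := adm_of_order_ideal (m + 1) (stdm k m I)
      (fun j => by classical exact Finset.filter_subset _ _) (stdm_shad k m I)
    refine ⟨r, l, h1, fun i hi => (h2 i hi).1, ?_⟩
    refine Polynomial.eq_of_infinite_eval_eq p (AP r l) ?_
    refine Set.Infinite.mono ?_ (((Set.Ici_infinite (max j₀ j₁)).image
      (f := fun n : ℕ => (n : ℚ)) Nat.cast_injective.injOn))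
    rintro _ ⟨j, hj, rfl⟩
    have hj' : max j₀ j₁ ≤ j := hj
    have h4 := hI j (by omega)
    have h5 := h3 j (by omega)
    rw [hdim_eq] at h4
    exact h4.symm.trans h5
  · rintro ⟨r, l, h1, h2, hp⟩
    have hp' : p = AP r l := hp
    have h3 := le_of_degree h1 h2 (hp' ▸ hdeg)
    obtain ⟨N, hN, -, j₀, hj⟩ := exists_order_ideal m r l m h1
      (fun i hi => ⟨h2 i hi, h3 i hi⟩) le_rfl
    refine ⟨monIdeal k m N hN, ?_, j₀, ?_⟩
    · intro f hf n
      rw [mem_monIdeal] at *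
      intro d hd
      refine hf d ?_
      rw [mem_support_iff, coeff_homogeneousComponent] at hd
      rw [mem_support_iff]
      intro h
      apply hd
      rw [h, ite_self]
    · intro j hjj
      rw [hdim_eq, stdm_monIdeal, hp']
      exact hj j hjj

end
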